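/- For every integer k ≥ 0, the graph L_k of order n = 4k + 6 has total domination number γt(L_k) = (n + 2)/2 = 2k + 4. -/

import Mathlib

open SimpleGraph

/-- The total domination number of a finite simple graph `G`: the minimum size of a set `S`
of vertices such that every vertex of `G` has a neighbor in `S`. -/
noncomputable def totalDominationNumber {V : Type*} [Fintype V] (G : SimpleGraph V) : ℕ :=
  sInf {n | ∃ S : Finset V, S.card = n ∧ ∀ v : V, ∃ u ∈ S, G.Adj v u}

/-- The almost total domination number of `G` with respect to `v`: the minimum size of a set
`S` with `v ∈ S`, `v` having no neighbor in `S`, and every vertex other than `v` having a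
neighbor in `S`. -/
noncomputable def almostTotalDominationNumber {V : Type*} [Fintype V] (G : SimpleGraph V)
    (v : V) : ℕ :=
  sInf {n | ∃ S : Finset V, S.card = n ∧ v ∈ S ∧ (∀ u ∈ S, ¬ G.Adj v u) ∧
    ∀ w : V, w ≠ v → ∃ u ∈ S, G.Adj w u}

/-- The graph obtained from `G` by deleting the vertex `v` and all incident edges. -/
def deleteVert {V : Type*} (G : SimpleGraph V) (v : V) : SimpleGraph {w : V // w ≠ v} :=
  G.induce {w : V | w ≠ v}

/-- The cycle `C_n` on vertex set `Fin n`. -/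
def cycleG (n : ℕ) : SimpleGraph (Fin n) :=
  SimpleGraph.fromRel (fun p q => (q : ℕ) = ((p : ℕ) + 1) % n)

/-- The 2-corona `C_k ∘ P_2` of the cycle `C_k`.  Vertex `(0, i)` is the cycle vertex `x_i`,
`(1, i)` is `x_i'` and `(2, i)` is `x_i''`, with pendant path `x_i x_i' x_i''`. -/
def coronaRel (k : ℕ) (p q : Fin 3 × Fin k) : Prop :=
  (p.1 = 0 ∧ q.1 = 0 ∧ (q.2 : ℕ) = ((p.2 : ℕ) + 1) % k) ∨
  (p.1 = 0 ∧ q.1 = 1 ∧ p.2 = q.2) ∨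
  (p.1 = 1 ∧ q.1 = 2 ∧ p.2 = q.2)

def coronaGraph (k : ℕ) : SimpleGraph (Fin 3 × Fin k) :=
  SimpleGraph.fromRel (coronaRel k)

/-- The edges of `G_k` common to `G_k`, `H_k`, `F_k`, `L_k` (0-indexed: `(0,i) = a_{i+1}`,
`(1,i) = b_{i+1}`, `(2,i) = c_{i+1}`, `(3,i) = d_{i+1}`): the two paths
`a_1 b_1 a_2 b_2 … a_k b_k` and `c_1 d_1 c_2 d_2 … c_k d_k`, and the edges `a_i d_i`,
`b_i c_i`. -/
def gkBase (k : ℕ) (p q : Fin 4 × Fin k) : Prop :=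
  (p.1 = 0 ∧ q.1 = 1 ∧ p.2 = q.2) ∨
  (p.1 = 1 ∧ q.1 = 0 ∧ (p.2 : ℕ) + 1 = (q.2 : ℕ)) ∨
  (p.1 = 2 ∧ q.1 = 3 ∧ p.2 = q.2) ∨
  (p.1 = 3 ∧ q.1 = 2 ∧ (p.2 : ℕ) + 1 = (q.2 : ℕ)) ∨
  (p.1 = 0 ∧ q.1 = 3 ∧ p.2 = q.2) ∨
  (p.1 = 1 ∧ q.1 = 2 ∧ p.2 = q.2)

/-- The cubic graph `G_k`: the base edges together with `a_1 c_1` and `b_k d_k`. -/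
def gkRel (k : ℕ) (p q : Fin 4 × Fin k) : Prop :=
  gkBase k p q ∨
  (p.1 = 0 ∧ q.1 = 2 ∧ (p.2 : ℕ) = 0 ∧ (q.2 : ℕ) = 0) ∨
  (p.1 = 1 ∧ q.1 = 3 ∧ (p.2 : ℕ) = k - 1 ∧ (q.2 : ℕ) = k - 1)

def GkGraph (k : ℕ) : SimpleGraph (Fin 4 × Fin k) :=
  SimpleGraph.fromRel (gkRel k)

/-- The cubic graph `H_k`: the base edges together with `a_1 b_k` and `c_1 d_k`. -/
def hkRel (k : ℕ) (p q : Fin 4 × Fin k) : Prop :=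
  gkBase k p q ∨
  (p.1 = 0 ∧ q.1 = 1 ∧ (p.2 : ℕ) = 0 ∧ (q.2 : ℕ) = k - 1) ∨
  (p.1 = 2 ∧ q.1 = 3 ∧ (p.2 : ℕ) = 0 ∧ (q.2 : ℕ) = k - 1)

def HkGraph (k : ℕ) : SimpleGraph (Fin 4 × Fin k) :=
  SimpleGraph.fromRel (hkRel k)

/-- Vertices of `F_k`: the vertices of `G_k` together with `v_1, v_2, v_3`
(encoded `Sum.inr 0`, `Sum.inr 1`, `Sum.inr 2`). -/
abbrev FkVert (k : ℕ) := (Fin 4 × Fin k) ⊕ Fin 3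

/-- `F_k` is obtained from `G_k` by subdividing the edge `a_1 c_1` three times,
giving the path `a_1 v_1 v_2 v_3 c_1`. -/
def fkRel (k : ℕ) (p q : FkVert k) : Prop :=
  match p, q with
  | Sum.inl p, Sum.inl q =>
      gkBase k p q ∨
      (p.1 = 1 ∧ q.1 = 3 ∧ (p.2 : ℕ) = k - 1 ∧ (q.2 : ℕ) = k - 1)
  | Sum.inl p, Sum.inr j =>
      (p.1 = 0 ∧ (p.2 : ℕ) = 0 ∧ j = 0) ∨ (p.1 = 2 ∧ (p.2 : ℕ) = 0 ∧ j = 2)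
  | Sum.inr i, Sum.inr j => (j : ℕ) = (i : ℕ) + 1
  | Sum.inr _, Sum.inl _ => False

def FkGraph (k : ℕ) : SimpleGraph (FkVert k) :=
  SimpleGraph.fromRel (fkRel k)

/-- Vertices of `L_k`: the vertices of `G_k` together with `v_1, v_2, v_3`
(encoded `Sum.inr (0, j)`) and `u_1, u_2, u_3` (encoded `Sum.inr (1, j)`). -/
abbrev LkVert (k : ℕ) := (Fin 4 × Fin k) ⊕ (Fin 2 × Fin 3)

/-- `L_k` is obtained from `G_k` by subdividing the edge `a_1 c_1` three times (path
`a_1 v_1 v_2 v_3 c_1`) and the edge `b_k d_k` three times (path `b_k u_1 u_2 u_3 d_k`). -/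
def lkRel (k : ℕ) (p q : LkVert k) : Prop :=
  match p, q with
  | Sum.inl p, Sum.inl q => gkBase k p q
  | Sum.inl p, Sum.inr j =>
      (p.1 = 0 ∧ (p.2 : ℕ) = 0 ∧ j = ((0 : Fin 2), (0 : Fin 3))) ∨
      (p.1 = 2 ∧ (p.2 : ℕ) = 0 ∧ j = ((0 : Fin 2), (2 : Fin 3))) ∨
      (p.1 = 1 ∧ (p.2 : ℕ) = k - 1 ∧ j = ((1 : Fin 2), (0 : Fin 3))) ∨
      (p.1 = 3 ∧ (p.2 : ℕ) = k - 1 ∧ j = ((1 : Fin 2), (2 : Fin 3)))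
  | Sum.inr i, Sum.inr j => i.1 = j.1 ∧ (j.2 : ℕ) = (i.2 : ℕ) + 1
  | Sum.inr _, Sum.inl _ => False

def LkGraph (k : ℕ) : SimpleGraph (LkVert k) :=
  SimpleGraph.fromRel (lkRel k)

/-- The generalized Petersen graph `GP(8,3)` of order 16: `(0, i) = u_i`, `(1, i) = w_i`. -/
def gpRel (p q : Fin 2 × Fin 8) : Prop :=
  (p.1 = 0 ∧ q.1 = 0 ∧ (q.2 : ℕ) = ((p.2 : ℕ) + 1) % 8) ∨
  (p.1 = 0 ∧ q.1 = 1 ∧ p.2 = q.2) ∨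
  (p.1 = 1 ∧ q.1 = 1 ∧ (q.2 : ℕ) = ((p.2 : ℕ) + 3) % 8)

def GP16 : SimpleGraph (Fin 2 × Fin 8) :=
  SimpleGraph.fromRel gpRel

/-- If `S` meets every open neighbourhood and no smaller such set exists, then `S` realizes the
total domination number. -/
lemma totalDominationNumber_eq {V : Type*} [Fintype V] {G : SimpleGraph V} {n : ℕ}
    (S : Finset V) (hcard : S.card = n) (hS : ∀ v, ∃ u ∈ S, G.Adj v u)
    (hmin : ∀ T : Finset V, (∀ v, ∃ u ∈ T, G.Adj v u) → n ≤ T.card) :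
    totalDominationNumber G = n :=
  le_antisymm (Nat.sInf_le ⟨S, hcard, hS⟩)
    (le_csInf ⟨n, S, hcard, hS⟩ (by rintro m ⟨T, rfl, hT⟩; exact hmin T hT))

lemma totalDominationNumber_cycleG_six : totalDominationNumber (cycleG 6) = 4 := by
  refine totalDominationNumber_eq {0, 1, 2, 3} (by decide) ?_ ?_
  · simp only [cycleG, SimpleGraph.fromRel_adj]
    decide
  · simp only [cycleG, SimpleGraph.fromRel_adj]
    decide

/-- A sequence in which every zero term is preceded by a term at least `2`, closed by a last
term `q` obeying the same rule, has sum at least its length. -/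
lemma add_two_le_add_sum_range (k q : ℕ) (x : ℕ → ℕ) (h0 : 1 ≤ x 0)
    (hx : ∀ i < k, x (i + 1) = 0 → 2 ≤ x i) (hq : q = 0 → 2 ≤ x k) :
    k + 2 ≤ q + ∑ i ∈ Finset.range (k + 1), x i := by
  have key : ∀ j ≤ k, j + max 1 (x j) ≤ ∑ i ∈ Finset.range (j + 1), x i := by
    intro j
    induction j with
    | zero => intro _; simp; omega
    | succ j ih =>
      intro hj
      rw [Finset.sum_range_succ]
      have := ih (by omega)
      have := hx j (by omega)
      omega
  have := key k le_rfl
  omega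

section LowerBound

variable {k : ℕ} {S : Finset (LkVert k)}

/-- The membership indicator of `S` at the vertex `(t, i)`, extended by `0` to all `i`. -/
def baseIndicator (S : Finset (LkVert k)) (t : Fin 4) (i : ℕ) : ℕ :=
  if h : i < k then if Sum.inl (t, ⟨i, h⟩) ∈ S then 1 else 0 else 0

/-- The membership indicator of `S` at the vertex `(s, t)` of the two subdivided edges. -/
def endIndicator (S : Finset (LkVert k)) (s : Fin 2) (t : Fin 3) : ℕ :=
  if Sum.inr (s, t) ∈ S then 1 else 0

lemma card_eq_sum_indicators (S : Finset (LkVert k)) :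
    S.card = ∑ t, ∑ i ∈ Finset.range k, baseIndicator S t i + ∑ s, ∑ t, endIndicator S s t := by
  have : S.card = ∑ v, if v ∈ S then 1 else 0 := by simp
  rw [this, Fintype.sum_sum_type, Fintype.sum_prod_type, Fintype.sum_prod_type]
  simp only [Finset.sum_range, baseIndicator, endIndicator, Fin.is_lt, dif_pos, Fin.eta]



/-- Column sums of the indicator along `{v₁, v₃}, {b₁, d₁}, …, {b_k, d_k}`. -/
def rightColumn (S : Finset (LkVert k)) : ℕ → ℕ
  | 0 => endIndicator S 0 0 + endIndicator S 0 2
  | i + 1 => baseIndicator S 1 i + baseIndicator S 3 i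

/-- Column sums of the indicator along `{a₁, c₁}, …, {a_k, c_k}, {u₁, u₃}`. -/
def leftColumn (S : Finset (LkVert k)) (i : ℕ) : ℕ :=
  if i < k then baseIndicator S 0 i + baseIndicator S 2 i
  else endIndicator S 1 0 + endIndicator S 1 2

lemma one_le_rightColumn_zero (hS : ∀ v, ∃ u ∈ S, (LkGraph k).Adj v u) :
    1 ≤ rightColumn S 0 := by
  obtain ⟨⟨t, j⟩ | ⟨s, t⟩, hu, hadj⟩ := hS (Sum.inr (0, 1)) <;>
  fin_cases t <;> try fin_cases s
  all_goals simp_all [LkGraph, lkRel, gkBase, endIndicator, rightColumn]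

lemma one_le_leftColumn_last (hS : ∀ v, ∃ u ∈ S, (LkGraph k).Adj v u) :
    1 ≤ leftColumn S k := by
  obtain ⟨⟨t, j⟩ | ⟨s, t⟩, hu, hadj⟩ := hS (Sum.inr (1, 1)) <;>
  fin_cases t <;> try fin_cases s
  all_goals simp_all [LkGraph, lkRel, gkBase, endIndicator, leftColumn]

lemma baseIndicator_of_mem {t : Fin 4} {j : Fin k} (h : Sum.inl (t, j) ∈ S) :
    baseIndicator S t j = 1 := by
  simp [baseIndicator, h]

lemma endIndicator_of_mem {s : Fin 2} {t : Fin 3} (h : Sum.inr (s, t) ∈ S) :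
    endIndicator S s t = 1 := by
  simp [endIndicator, h]

lemma one_le_of_dominates_a (hS : ∀ v, ∃ u ∈ S, (LkGraph k).Adj v u) {i : ℕ} (hi : i < k) :
    1 ≤ (if i = 0 then endIndicator S 0 0 else baseIndicator S 1 (i - 1)) +
      baseIndicator S 1 i + baseIndicator S 3 i := by
  obtain ⟨⟨t, j⟩ | ⟨s, t⟩, hu, hadj⟩ := hS (Sum.inl (0, ⟨i, hi⟩)) <;>
  fin_cases t <;> try fin_cases s
  all_goals simp [LkGraph, lkRel, gkBase, Fin.ext_iff] at hadj
  all_goals first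
    | have := baseIndicator_of_mem hu
    | have := endIndicator_of_mem hu
  all_goals grind

lemma one_le_of_dominates_c (hS : ∀ v, ∃ u ∈ S, (LkGraph k).Adj v u) {i : ℕ} (hi : i < k) :
    1 ≤ (if i = 0 then endIndicator S 0 2 else baseIndicator S 3 (i - 1)) +
      baseIndicator S 1 i + baseIndicator S 3 i := by
  obtain ⟨⟨t, j⟩ | ⟨s, t⟩, hu, hadj⟩ := hS (Sum.inl (2, ⟨i, hi⟩)) <;>
  fin_cases t <;> try fin_cases s
  all_goals simp [LkGraph, lkRel, gkBase, Fin.ext_iff] at hadj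
  all_goals first
    | have := baseIndicator_of_mem hu
    | have := endIndicator_of_mem hu
  all_goals grind

lemma one_le_of_dominates_b (hS : ∀ v, ∃ u ∈ S, (LkGraph k).Adj v u) {i : ℕ} (hi : i < k) :
    1 ≤ baseIndicator S 0 i + baseIndicator S 2 i +
      (if i + 1 < k then baseIndicator S 0 (i + 1) else endIndicator S 1 0) := by
  obtain ⟨⟨t, j⟩ | ⟨s, t⟩, hu, hadj⟩ := hS (Sum.inl (1, ⟨i, hi⟩)) <;>
  fin_cases t <;> try fin_cases s
  all_goals simp [LkGraph, lkRel, gkBase, Fin.ext_iff] at hadj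
  all_goals first
    | have := baseIndicator_of_mem hu
    | have := endIndicator_of_mem hu
  all_goals grind

lemma one_le_of_dominates_d (hS : ∀ v, ∃ u ∈ S, (LkGraph k).Adj v u) {i : ℕ} (hi : i < k) :
    1 ≤ baseIndicator S 0 i + baseIndicator S 2 i +
      (if i + 1 < k then baseIndicator S 2 (i + 1) else endIndicator S 1 2) := by
  obtain ⟨⟨t, j⟩ | ⟨s, t⟩, hu, hadj⟩ := hS (Sum.inl (3, ⟨i, hi⟩)) <;>
  fin_cases t <;> try fin_cases s
  all_goals simp [LkGraph, lkRel, gkBase, Fin.ext_iff] at hadj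
  all_goals first
    | have := baseIndicator_of_mem hu
    | have := endIndicator_of_mem hu
  all_goals grind

lemma one_le_of_dominates_u₁ (hS : ∀ v, ∃ u ∈ S, (LkGraph k).Adj v u) :
    1 ≤ endIndicator S 1 1 + baseIndicator S 1 (k - 1) := by
  obtain ⟨⟨t, j⟩ | ⟨s, t⟩, hu, hadj⟩ := hS (Sum.inr (1, 0)) <;>
  fin_cases t <;> try fin_cases s
  all_goals simp [LkGraph, lkRel] at hadj
  all_goals first
    | have := baseIndicator_of_mem hu
    | have := endIndicator_of_mem hu
  all_goals grind

lemma one_le_of_dominates_u₃ (hS : ∀ v, ∃ u ∈ S, (LkGraph k).Adj v u) :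
    1 ≤ endIndicator S 1 1 + baseIndicator S 3 (k - 1) := by
  obtain ⟨⟨t, j⟩ | ⟨s, t⟩, hu, hadj⟩ := hS (Sum.inr (1, 2)) <;>
  fin_cases t <;> try fin_cases s
  all_goals simp [LkGraph, lkRel] at hadj
  all_goals first
    | have := baseIndicator_of_mem hu
    | have := endIndicator_of_mem hu
  all_goals grind

lemma one_le_of_dominates_v₁ (hS : ∀ v, ∃ u ∈ S, (LkGraph k).Adj v u) :
    1 ≤ endIndicator S 0 1 + baseIndicator S 0 0 := by
  obtain ⟨⟨t, j⟩ | ⟨s, t⟩, hu, hadj⟩ := hS (Sum.inr (0, 0)) <;>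
  fin_cases t <;> try fin_cases s
  all_goals simp [LkGraph, lkRel] at hadj
  all_goals first
    | have := baseIndicator_of_mem hu
    | have := endIndicator_of_mem hu
  all_goals grind

lemma one_le_of_dominates_v₃ (hS : ∀ v, ∃ u ∈ S, (LkGraph k).Adj v u) :
    1 ≤ endIndicator S 0 1 + baseIndicator S 2 0 := by
  obtain ⟨⟨t, j⟩ | ⟨s, t⟩, hu, hadj⟩ := hS (Sum.inr (0, 2)) <;>
  fin_cases t <;> try fin_cases s
  all_goals simp [LkGraph, lkRel] at hadj
  all_goals first
    | have := baseIndicator_of_mem hu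
    | have := endIndicator_of_mem hu
  all_goals grind

lemma two_le_rightColumn (hS : ∀ v, ∃ u ∈ S, (LkGraph k).Adj v u) {i : ℕ} (hi : i < k)
    (h : rightColumn S (i + 1) = 0) : 2 ≤ rightColumn S i := by
  have ha := one_le_of_dominates_a hS hi
  have hc := one_le_of_dominates_c hS hi
  cases i <;> simp_all [rightColumn] <;> omega

lemma two_le_leftColumn (hS : ∀ v, ∃ u ∈ S, (LkGraph k).Adj v u) {i : ℕ} (hi : i < k)
    (h : leftColumn S i = 0) : 2 ≤ leftColumn S (i + 1) := by
  have hb := one_le_of_dominates_b hS hi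
  have hd := one_le_of_dominates_d hS hi
  simp only [leftColumn, hi, if_true] at h
  unfold leftColumn
  split_ifs at hb hd ⊢ <;> omega

lemma le_card_of_dominates (hk : 1 ≤ k) (hS : ∀ v, ∃ u ∈ S, (LkGraph k).Adj v u) :
    2 * k + 4 ≤ S.card := by
  have hright := add_two_le_add_sum_range k (endIndicator S 1 1) (rightColumn S)
    (one_le_rightColumn_zero hS) (fun i hi => two_le_rightColumn hS hi) (by
      intro h
      have hu₁ := one_le_of_dominates_u₁ hS
      have hu₃ := one_le_of_dominates_u₃ hS
      obtain ⟨n, rfl⟩ := Nat.exists_eq_add_of_le' hk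
      simp_all [rightColumn]
      omega)
  have hleft := add_two_le_add_sum_range k (endIndicator S 0 1) (fun i => leftColumn S (k - i))
    (one_le_leftColumn_last hS)
    (fun i hi h => by
      have := two_le_leftColumn hS (i := k - (i + 1)) (by omega) h
      rwa [show k - (i + 1) + 1 = k - i by omega] at this)
    (by
      intro h
      have hv₁ := one_le_of_dominates_v₁ hS
      have hv₃ := one_le_of_dominates_v₃ hS
      simp only [leftColumn, Nat.sub_self]
      split_ifs <;> omega)
  have hreflect := Finset.sum_range_reflect (leftColumn S) (k + 1)
  simp only [Nat.add_sub_cancel] at hreflect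
  have hlast : leftColumn S k = endIndicator S 1 0 + endIndicator S 1 2 := by simp [leftColumn]
  have hinit : ∑ i ∈ Finset.range k, leftColumn S i =
      ∑ i ∈ Finset.range k, (baseIndicator S 0 i + baseIndicator S 2 i) :=
    Finset.sum_congr rfl fun i hi => by simp [leftColumn, Finset.mem_range.mp hi]
  rw [hreflect, Finset.sum_range_succ, hlast, hinit, Finset.sum_add_distrib] at hleft
  rw [Finset.sum_range_succ'] at hright
  simp only [rightColumn, Finset.sum_add_distrib] at hright
  rw [card_eq_sum_indicators]
  simp only [Fin.sum_univ_four, Fin.sum_univ_two, Fin.sum_univ_three]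
  omega

end LowerBound

/-- The vertices `a_i`, `b_i` for all `i`, together with `v₁`, `v₂`, `u₁`, `u₂`. -/
def lkDominatingSet (k : ℕ) : Finset (LkVert k) :=
  (({0, 1} : Finset (Fin 4)) ×ˢ Finset.univ).disjSum (Finset.univ ×ˢ {0, 1})

lemma card_lkDominatingSet (k : ℕ) : (lkDominatingSet k).card = 2 * k + 4 := by
  simp [lkDominatingSet]

lemma lkDominatingSet_dominates {k : ℕ} (v : LkVert k) :
    ∃ u ∈ lkDominatingSet k, (LkGraph k).Adj v u := by
  obtain ⟨t, j⟩ | ⟨s, t⟩ := v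
  · fin_cases t
    · exact ⟨Sum.inl (1, j), by simp [lkDominatingSet, LkGraph, lkRel, gkBase]⟩
    · exact ⟨Sum.inl (0, j), by simp [lkDominatingSet, LkGraph, lkRel, gkBase]⟩
    · exact ⟨Sum.inl (1, j), by simp [lkDominatingSet, LkGraph, lkRel, gkBase]⟩
    · exact ⟨Sum.inl (0, j), by simp [lkDominatingSet, LkGraph, lkRel, gkBase]⟩
  · fin_cases t
    · exact ⟨Sum.inr (s, 1), by simp [lkDominatingSet, LkGraph, lkRel]⟩
    · exact ⟨Sum.inr (s, 0), by simp [lkDominatingSet, LkGraph, lkRel]⟩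
    · exact ⟨Sum.inr (s, 1), by simp [lkDominatingSet, LkGraph, lkRel]⟩

/-- For every `k ≥ 0`, the graph `L_k` of order `n = 4k + 6` has total domination number
`(n + 2)/2 = 2k + 4`  (here `L_0` is the 6-cycle `C_6`). -/
theorem totalDominationNumber_Lk (k : ℕ) :
    (k = 0 → totalDominationNumber (cycleG 6) = 2 * k + 4) ∧
    (1 ≤ k → totalDominationNumber (LkGraph k) = 2 * k + 4) := by
  exact ⟨fun hk => by rw [hk]; exact totalDominationNumber_cycleG_six,
    fun hk => totalDominationNumber_eq _ (card_lkDominatingSet k) lkDominatingSet_dominates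
      fun _ hT => le_card_of_dominates hk hT⟩
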